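/- Let T be the 4×4 complex matrix [[0,0,1,1],[1,1,0,0],[−1,1,0,0],[0,0,−1,1]] and let M_ĝ be the 4×4 complex matrix (1/2)·[[19,0,0,7],[0,7,5,0],[0,5,7,0],[7,0,0,19]]. Then for every natural number s, the s-th matrix power satisfies (M_ĝ)^s = T · diag(1, 6^s, 6^s, 13^s) · T⁻¹. (This identifies the signature matrix of the recursive gadget N_s built from s copies of ĝ, used in the interpolation argument.) -/

import Mathlib

open Matrix

/-- Powers of a matrix `A` diagonalized by an invertible matrix `T`. -/
theorem Matrix.pow_eq_mul_diagonal_pow_mul_inv {n R : Type*} [Fintype n] [DecidableEq n]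
    [CommRing R] {A T : Matrix n n R} {d : n → R} (hT : IsUnit T.det)
    (h : A * T = T * Matrix.diagonal d) (s : ℕ) :
    A ^ s = T * Matrix.diagonal (d ^ s) * T⁻¹ := by
  have hs : SemiconjBy T (Matrix.diagonal d) A := h.symm
  rw [← Matrix.diagonal_pow, (hs.pow_right s).eq, Matrix.mul_nonsing_inv_cancel_right _ _ hT]

/-- For every natural number `s`, the `s`-th power of
`M_ĝ = (1/2)·[[19,0,0,7],[0,7,5,0],[0,5,7,0],[7,0,0,19]]` is
`T ⬝ diag(1, 6^s, 6^s, 13^s) ⬝ T⁻¹`, where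
`T = [[0,0,1,1],[1,1,0,0],[-1,1,0,0],[0,0,-1,1]]`. This identifies the signature matrix
of the recursive gadget `N_s` built from `s` copies of `ĝ`. -/
theorem Mghat_pow (s : ℕ) :
    let T : Matrix (Fin 4) (Fin 4) ℂ := !![0, 0, 1, 1; 1, 1, 0, 0; -1, 1, 0, 0; 0, 0, -1, 1]
    let Mghat : Matrix (Fin 4) (Fin 4) ℂ :=
      (1 / 2 : ℂ) • !![19, 0, 0, 7; 0, 7, 5, 0; 0, 5, 7, 0; 7, 0, 0, 19]
    Mghat ^ s = T * Matrix.diagonal ![1, 6 ^ s, 6 ^ s, 13 ^ s] * T⁻¹ := by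
  intro T Mghat
  have hTT : T * ((1 / 2 : ℂ) • Tᵀ) = 1 := by
    ext i j
    fin_cases i <;> fin_cases j <;>
      simp [T, Matrix.mul_apply, Fin.sum_univ_four] <;> norm_num
  have hM : Mghat * T = T * Matrix.diagonal ![1, 6, 6, 13] := by
    ext i j
    fin_cases i <;> fin_cases j <;>
      simp [T, Mghat, Matrix.mul_apply, Fin.sum_univ_four, Matrix.diagonal_apply] <;> norm_num
  have hd : (![1, 6, 6, 13] : Fin 4 → ℂ) ^ s = ![1, 6 ^ s, 6 ^ s, 13 ^ s] := by
    ext i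
    fin_cases i <;> simp
  rw [← hd]
  exact Matrix.pow_eq_mul_diagonal_pow_mul_inv (Matrix.isUnit_det_of_right_inverse hTT) hM s
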